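/- arXiv:1602.05657 — 8 statements merged into one kernel-verified Lean document; each statement's English description precedes it below -/
import Mathlib

section
/- Let A be a finite set of at least two integers, each at least 2, whose greatest common divisor is 1, let a = min A, let g be the Frobenius number of A, and let λ be a positive integer. Then g < λ if and only if every integer k with λ ≤ k ≤ λ + a − 1 is a nonnegative integer combination of A. -/
/-- If an additive submonoid of `ℕ` contains a positive `a` and the `a` consecutive integers
starting at `m`, then it contains every integer that is at least `m`. -/
theorem AddSubmonoid.mem_of_le_of_forall_mem_window {S : AddSubmonoid ℕ} {a m n : ℕ}
    (ha : 0 < a) (haS : a ∈ S) (hwindow : ∀ k, m ≤ k → k < m + a → k ∈ S) (hmn : m ≤ n) :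
    n ∈ S := by
  induction n using Nat.strong_induction_on with
  | _ n ih =>
    rcases lt_or_ge n (m + a) with hlt | hge
    · exact hwindow n hmn hlt
    · have hmem := S.add_mem (ih (n - a) (by omega) (by omega)) haS
      rwa [Nat.sub_add_cancel (by omega)] at hmem

/-- For A a finite set of at least two integers, each at least 2, with
gcd 1, Frobenius number g, and a positive integer λ: g < λ iff every integer in
[λ, λ + min A − 1] is a nonnegative integer combination of A. -/
theorem stmt_1 (A : Finset ℕ) (hcard : 2 ≤ A.card) (h2 : ∀ x ∈ A, 2 ≤ x)
    (hgcd : A.gcd id = 1) (g : ℕ)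
    (hg : IsGreatest {n : ℕ | n ∉ AddSubmonoid.closure (A : Set ℕ)} g)
    (lam : ℕ) (hlam : 0 < lam) :
    g < lam ↔
      ∀ k : ℕ, lam ≤ k → k ≤ lam + A.min' (Finset.card_pos.mp (by omega)) - 1 →
        k ∈ AddSubmonoid.closure (A : Set ℕ) := by
  have hne : A.Nonempty := Finset.card_pos.mp (by omega)
  have hmin : A.min' hne ∈ A := A.min'_mem hne
  have hpos : 0 < A.min' hne := two_pos.trans_le (h2 _ hmin)
  constructor
  · intro hlt k hk _
    by_contra hkA
    exact absurd (hg.2 hkA) (by omega)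
  · intro hwindow
    by_contra! hle
    exact hg.1 (AddSubmonoid.mem_of_le_of_forall_mem_window hpos
      (AddSubmonoid.subset_closure hmin) (fun k hk hka => hwindow k hk (by omega)) hle)
end

section
/- Let q ≥ 1 be an integer and b = q + 1. If ν ⊆ Fin q × Fin q × Fin q is a perfect matching, then for every natural number n with n ≤ b^(3q) − 1 there exists a function s on ν with s(t) ∈ m(t) for every t ∈ ν such that Σ_{t ∈ ν} s(t) = n. -/
/-- The base-`b` digit of `n` at position `j`. -/
def digit (b j n : ℕ) : ℕ := n / b ^ j % b

/-- A subset `ν` of `Fin q × Fin q × Fin q` (as a finset) is a perfect matching if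
it has exactly `q` elements and no two distinct elements agree in any coordinate. -/
def IsPerfectMatching (q : ℕ) (ν : Finset (Fin q × Fin q × Fin q)) : Prop :=
  ν.card = q ∧ ∀ t ∈ ν, ∀ t' ∈ ν, t ≠ t' →
    t.1 ≠ t'.1 ∧ t.2.1 ≠ t'.2.1 ∧ t.2.2 ≠ t'.2.2

/-- The match-set `m(t)` of a triple `t = (j₁, j₂, j₃)`: all numbers of the form
`d₁·b^(2q+j₁) + d₂·b^(q+j₂) + d₃·b^(j₃)` with `d₁, d₂, d₃ ∈ [0, q]`, where `b = q+1`. -/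
def matchSet (q : ℕ) (t : Fin q × Fin q × Fin q) : Set ℕ :=
  {n | ∃ d₁ d₂ d₃ : ℕ, d₁ ≤ q ∧ d₂ ≤ q ∧ d₃ ≤ q ∧
    n = d₁ * (q + 1) ^ (2 * q + (t.1 : ℕ)) + d₂ * (q + 1) ^ (q + (t.2.1 : ℕ))
      + d₃ * (q + 1) ^ ((t.2.2 : ℕ))}

/-- The set `Ψ(t)` of constructed integers for a triple `t`, where `ρ` is the rank
function on `M₁`, `α = 3q + |M₁|` and `b = q + 1`.
For `t ∈ M₁`: `Ψ(t) = { b^α + d₀·b^(3q+ρ(t)) + s : d₀ ∈ [1, q], s ∈ m(t) }`;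
otherwise (for `t ∈ M₂`): `Ψ(t) = { b^α + s : s ∈ m(t) }`. -/
def Psi (q : ℕ) (M₁ : Finset (Fin q × Fin q × Fin q))
    (ρ : Fin q × Fin q × Fin q → ℕ) (t : Fin q × Fin q × Fin q) : Set ℕ :=
  if t ∈ M₁ then
    {n | ∃ d₀ s : ℕ, 1 ≤ d₀ ∧ d₀ ≤ q ∧ s ∈ matchSet q t ∧
      n = (q + 1) ^ (3 * q + M₁.card) + d₀ * (q + 1) ^ (3 * q + ρ t) + s}
  else
    {n | ∃ s ∈ matchSet q t, n = (q + 1) ^ (3 * q + M₁.card) + s}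

/-- `Ψ(P) = ⋃_{t ∈ M₁ ∪ M₂} Ψ(t)`. -/
def PsiP (q : ℕ) (M₁ M₂ : Finset (Fin q × Fin q × Fin q))
    (ρ : Fin q × Fin q × Fin q → ℕ) : Set ℕ :=
  ⋃ t ∈ (M₁ ∪ M₂ : Finset (Fin q × Fin q × Fin q)), Psi q M₁ ρ t

/-- The digits of `n` at the positions below `k` determine `n` modulo `b ^ k`. -/
theorem sum_range_digit_mul_pow (b n k : ℕ) :
    ∑ j ∈ Finset.range k, digit b j n * b ^ j = n % b ^ k := by
  induction k with
  | zero => simp [Nat.mod_one]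
  | succ k ih => rw [Finset.sum_range_succ, ih, Nat.mod_pow_succ, digit, mul_comm (b ^ k)]

theorem digit_succ_le (q j n : ℕ) : digit (q + 1) j n ≤ q :=
  Nat.le_of_lt_succ (Nat.mod_lt _ q.succ_pos)

/-- Summing over a set on which `f` is injective, and which has as many elements as the
codomain of `f`, amounts to summing over the codomain. -/
theorem Finset.sum_comp_eq_sum_univ_of_injOn {α β M : Type*} [Fintype β] [AddCommMonoid M]
    {s : Finset α} {f : α → β} (hf : Set.InjOn f s) (hs : s.card = Fintype.card β) (g : β → M) :
    ∑ a ∈ s, g (f a) = ∑ b, g b := by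
  classical
  rw [← Finset.sum_image (g := f) hf, Finset.eq_univ_of_card (s.image f)]
  rw [Finset.card_image_of_injOn hf, hs]

/-- if `ν` is a perfect matching then every `n ≤ b^(3q) − 1` is a sum,
over `t ∈ ν`, of elements `s(t) ∈ m(t)`. -/
theorem stmt_5 (q : ℕ) (hq : 1 ≤ q) (ν : Finset (Fin q × Fin q × Fin q))
    (hν : IsPerfectMatching q ν) (n : ℕ) (hn : n ≤ (q + 1) ^ (3 * q) - 1) :
    ∃ s : Fin q × Fin q × Fin q → ℕ,
      (∀ t ∈ ν, s t ∈ matchSet q t) ∧ ∑ t ∈ ν, s t = n := by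
  obtain ⟨hcard, hne⟩ := hν
  have hcard' : ν.card = Fintype.card (Fin q) := by rw [hcard, Fintype.card_fin]
  have h₁ : Set.InjOn (fun t : Fin q × Fin q × Fin q => t.1) ν := fun t ht t' ht' h =>
    by_contra fun hn => (hne t ht t' ht' hn).1 h
  have h₂ : Set.InjOn (fun t : Fin q × Fin q × Fin q => t.2.1) ν := fun t ht t' ht' h =>
    by_contra fun hn => (hne t ht t' ht' hn).2.1 h
  have h₃ : Set.InjOn (fun t : Fin q × Fin q × Fin q => t.2.2) ν := fun t ht t' ht' h =>
    by_contra fun hn => (hne t ht t' ht' hn).2.2 h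
  let c : ℕ → ℕ := fun j => digit (q + 1) j n * (q + 1) ^ j
  refine ⟨fun t => c (2 * q + t.1) + c (q + t.2.1) + c t.2.2, fun t _ =>
    ⟨_, _, _, digit_succ_le _ _ _, digit_succ_le _ _ _, digit_succ_le _ _ _, rfl⟩, ?_⟩
  have hlt : n < (q + 1) ^ (3 * q) := by
    have : 0 < (q + 1) ^ (3 * q) := by positivity
    omega
  rw [Finset.sum_add_distrib, Finset.sum_add_distrib,
    Finset.sum_comp_eq_sum_univ_of_injOn h₁ hcard' fun i : Fin q => c (2 * q + i),
    Finset.sum_comp_eq_sum_univ_of_injOn h₂ hcard' fun i : Fin q => c (q + i),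
    Finset.sum_comp_eq_sum_univ_of_injOn h₃ hcard' fun i : Fin q => c i,
    Fin.sum_univ_eq_sum_range (fun i => c (2 * q + i)),
    Fin.sum_univ_eq_sum_range (fun i => c (q + i)), Fin.sum_univ_eq_sum_range c]
  calc _ = ∑ j ∈ Finset.range (q + q + q), c j := by
        rw [Finset.sum_range_add, Finset.sum_range_add, two_mul]
        ring
    _ = n % (q + 1) ^ (3 * q) := by
        rw [sum_range_digit_mul_pow]
        congr 2
        ring
    _ = n := Nat.mod_eq_of_lt hlt
end

section
/- Let q ≥ 1 be an integer and b = q + 1. Let ν ⊆ Fin q × Fin q × Fin q be a set with at most q elements, and suppose there is a function s on ν with s(t) ∈ m(t) for every t ∈ ν such that Σ_{t ∈ ν} s(t) = b^(3q) − 1. Then ν has exactly q elements and ν is a perfect matching. -/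
theorem digit_mul_pow_add_lt {b d e f n : ℕ} (hd : d < b) (hn : n < b ^ e) (hef : e < f) :
    d * b ^ e + n < b ^ f :=
  calc d * b ^ e + n < (d + 1) * b ^ e := by linarith
    _ ≤ b * b ^ e := Nat.mul_le_mul_right _ hd
    _ = b ^ (e + 1) := by ring
    _ ≤ b ^ f := Nat.pow_le_pow_right (by omega) hef

/-- Prepending a base-`b` digit at a position `e ≠ p` keeps the digit at position `p` zero. -/
theorem digit_mul_pow_add_mod_lt {b d e n p : ℕ} (hd : d < b) (hn : n < b ^ e) (hep : e ≠ p)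
    (h : n % b ^ (p + 1) < b ^ p) : (d * b ^ e + n) % b ^ (p + 1) < b ^ p := by
  rcases lt_or_gt_of_ne hep with hlt | hgt
  · exact (Nat.mod_le _ _).trans_lt (digit_mul_pow_add_lt hd hn hlt)
  · obtain ⟨k, hk⟩ := (pow_dvd_pow b hgt).mul_left d
    rwa [hk, Nat.mul_add_mod]

theorem mod_lt_of_mem_matchSet {q n p : ℕ} {t : Fin q × Fin q × Fin q} (hn : n ∈ matchSet q t)
    (h₁ : 2 * q + (t.1 : ℕ) ≠ p) (h₂ : q + (t.2.1 : ℕ) ≠ p) (h₃ : (t.2.2 : ℕ) ≠ p) :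
    n % (q + 1) ^ (p + 1) < (q + 1) ^ p := by
  obtain ⟨d₁, d₂, d₃, hd₁, hd₂, hd₃, rfl⟩ := hn
  rw [add_assoc, ← add_zero (d₃ * _)]
  have low : d₃ * (q + 1) ^ (t.2.2 : ℕ) + 0 < (q + 1) ^ (q + (t.2.1 : ℕ)) :=
    digit_mul_pow_add_lt (by omega) (by positivity) (by omega)
  refine digit_mul_pow_add_mod_lt (by omega)
    (digit_mul_pow_add_lt (by omega) low (by omega)) h₁ ?_
  refine digit_mul_pow_add_mod_lt (by omega) low h₂ ?_
  exact digit_mul_pow_add_mod_lt (by omega) (by positivity) h₃ (by simp)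

/-- At most `q` numbers whose base-`(q + 1)` digit at position `p` vanishes cannot sum to a number
with all digits up to position `p` equal to `q`: the carry into position `p` is less than `q`. -/
theorem sum_ne_pow_sub_one {ι : Type*} {q p m : ℕ} (hq : 1 ≤ q) (hpm : p < m) (ν : Finset ι)
    (hcard : ν.card ≤ q) (s : ι → ℕ) (hs : ∀ t ∈ ν, s t % (q + 1) ^ (p + 1) < (q + 1) ^ p) :
    ∑ t ∈ ν, s t ≠ (q + 1) ^ m - 1 := by
  intro hsum
  have hpos : 0 < (q + 1) ^ p := by positivity
  have hle : ∑ t ∈ ν, s t % (q + 1) ^ (p + 1) ≤ q * ((q + 1) ^ p - 1) :=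
    (Finset.sum_le_card_nsmul ν _ _ fun t ht => Nat.le_sub_one_of_lt (hs t ht)).trans
      (Nat.mul_le_mul_right _ hcard)
  have hlt : q * ((q + 1) ^ p - 1) + 1 < (q + 1) ^ (p + 1) := by
    obtain ⟨k, hk⟩ := Nat.exists_eq_add_of_lt hpos
    rw [pow_succ, hk]
    simp only [zero_add, Nat.add_sub_cancel]
    nlinarith
  obtain ⟨c, hc⟩ := pow_dvd_pow (q + 1) (show p + 1 ≤ m from hpm)
  have hdvd : (q + 1) ^ (p + 1) ∣ ∑ t ∈ ν, s t % (q + 1) ^ (p + 1) + 1 := by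
    rw [Nat.dvd_iff_mod_eq_zero, Nat.add_mod, ← Finset.sum_nat_mod, ← Nat.add_mod, hsum,
      Nat.sub_add_cancel (Nat.one_le_pow _ _ (by omega)), hc]
    simp
  exact absurd (Nat.le_of_dvd (by omega) hdvd) (by omega)

/-- A map from at most `q` elements that hits all of `Fin q` is a bijection. -/
theorem card_eq_and_injOn_of_surjOn {ι : Type*} {q : ℕ} {ν : Finset ι} (hcard : ν.card ≤ q)
    (f : ι → Fin q) (hf : ∀ j, ∃ t ∈ ν, f t = j) : ν.card = q ∧ Set.InjOn f ν := by
  have himage : (ν.image f).card = q := by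
    rw [show ν.image f = Finset.univ by ext j; simpa using hf j, Finset.card_univ,
      Fintype.card_fin]
  have hν : ν.card = q := hcard.antisymm (himage ▸ Finset.card_image_le)
  exact ⟨hν, Finset.card_image_iff.mp (himage.trans hν.symm)⟩

/-- if at most `q` triples carry elements of their match-sets summing to
`b^(3q) − 1`, then there are exactly `q` triples and they form a perfect matching. -/
theorem stmt_6 (q : ℕ) (hq : 1 ≤ q) (ν : Finset (Fin q × Fin q × Fin q))
    (hcard : ν.card ≤ q) (s : Fin q × Fin q × Fin q → ℕ)
    (hs : ∀ t ∈ ν, s t ∈ matchSet q t)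
    (hsum : ∑ t ∈ ν, s t = (q + 1) ^ (3 * q) - 1) :
    ν.card = q ∧ IsPerfectMatching q ν := by
  have cover : ∀ p < 3 * q, ∃ t ∈ ν,
      2 * q + (t.1 : ℕ) = p ∨ q + (t.2.1 : ℕ) = p ∨ (t.2.2 : ℕ) = p := by
    intro p hp
    by_contra! h
    exact sum_ne_pow_sub_one hq hp ν hcard s (fun t ht =>
      mod_lt_of_mem_matchSet (hs t ht) (h t ht).1 (h t ht).2.1 (h t ht).2.2) hsum
  obtain ⟨hν, inj₁⟩ := card_eq_and_injOn_of_surjOn hcard (fun t => t.1) fun j => by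
    obtain ⟨t, ht, h⟩ := cover (2 * q + j) (by omega)
    exact ⟨t, ht, Fin.ext (by omega)⟩
  obtain ⟨-, inj₂⟩ := card_eq_and_injOn_of_surjOn hcard (fun t => t.2.1) fun j => by
    obtain ⟨t, ht, h⟩ := cover (q + j) (by omega)
    exact ⟨t, ht, Fin.ext (by omega)⟩
  obtain ⟨-, inj₃⟩ := card_eq_and_injOn_of_surjOn hcard (fun t => t.2.2) fun j => by
    obtain ⟨t, ht, h⟩ := cover j (by omega)
    exact ⟨t, ht, Fin.ext (by omega)⟩
  exact ⟨hν, hν, fun t ht t' ht' hne =>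
    ⟨fun h => hne (inj₁ ht ht' h), fun h => hne (inj₂ ht ht' h), fun h => hne (inj₃ ht ht' h)⟩⟩
end

section
/- Let q ≥ 1, b = q + 1, and let M₁, M₂, m, α, ρ, m(t), Ψ(t) be as in the construction. Let μ₁ ⊆ M₁ and μ₂ ⊆ M₂ be such that μ₁ ∪ μ₂ is a perfect matching. Let r be a natural number with q·b^α ≤ r < b^(α+1) such that, for every p ∈ Fin m, the base-b digit of r at position 3q + p is nonzero if and only if the triple of rank p (i.e., ρ⁻¹(p)) belongs to μ₁. Then there exists a function s on μ₁ ∪ μ₂ with s(t) ∈ Ψ(t) for every t ∈ μ₁ ∪ μ₂ such that Σ_{t ∈ μ₁ ∪ μ₂} s(t) = r. -/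
theorem sum_digit_add_div (b r k : ℕ) :
    ∑ j ∈ Finset.range k, digit b j r * b ^ j + r / b ^ k * b ^ k = r := by
  induction k with
  | zero => simp
  | succ k ih =>
    have h := Nat.div_add_mod (r / b ^ k) b
    rw [Nat.div_div_eq_div_mul, ← pow_succ] at h
    rw [Finset.sum_range_succ]
    conv_rhs => rw [← ih, ← h]
    simp only [digit]
    ring

theorem sum_comp_eq_sum_range {β : Type*} {q : ℕ} {ν : Finset β} {f : β → Fin q}
    (hcard : ν.card = q) (hf : Set.InjOn f ν) (g : ℕ → ℕ) :
    ∑ t ∈ ν, g (f t) = ∑ j ∈ Finset.range q, g j := by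
  classical
  have himage : ν.image f = Finset.univ := by
    apply Finset.eq_univ_of_card
    rw [Finset.card_image_of_injOn hf, hcard, Fintype.card_fin]
  rw [← Fin.sum_univ_eq_sum_range, ← himage, Finset.sum_image hf]

/-- statement (I) of the paper: if `μ₁ ∪ μ₂` is a perfect matching and
`r ∈ [q·b^α, b^(α+1))` has nonzero universal-quantification digits exactly at the
ranks of the triples in `μ₁`, then `r` is the sum, over `t ∈ μ₁ ∪ μ₂`, of elements
`s(t) ∈ Ψ(t)`. -/
theorem stmt_7 (q : ℕ) (hq : 1 ≤ q)
    (M₁ M₂ : Finset (Fin q × Fin q × Fin q)) (hdisj : Disjoint M₁ M₂)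
    (ρ : Fin q × Fin q × Fin q → ℕ)
    (hρ : Set.BijOn ρ ↑M₁ (Set.Iio M₁.card))
    (μ₁ μ₂ : Finset (Fin q × Fin q × Fin q)) (hμ₁ : μ₁ ⊆ M₁) (hμ₂ : μ₂ ⊆ M₂)
    (hpm : IsPerfectMatching q (μ₁ ∪ μ₂))
    (r : ℕ)
    (hr1 : q * (q + 1) ^ (3 * q + M₁.card) ≤ r)
    (hr2 : r < (q + 1) ^ (3 * q + M₁.card + 1))
    (hdig : ∀ t ∈ M₁, (digit (q + 1) (3 * q + ρ t) r ≠ 0 ↔ t ∈ μ₁)) :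
    ∃ s : Fin q × Fin q × Fin q → ℕ,
      (∀ t ∈ μ₁ ∪ μ₂, s t ∈ Psi q M₁ ρ t) ∧ ∑ t ∈ μ₁ ∪ μ₂, s t = r := by
  classical
  obtain ⟨hcard, hinj⟩ := hpm
  set b := q + 1 with hb
  set g : ℕ → ℕ := fun j => digit b j r * b ^ j with hg
  have hdle : ∀ j, digit b j r ≤ q := fun j => Nat.le_of_lt_succ (Nat.mod_lt _ (by omega))
  have h₁ := sum_comp_eq_sum_range (f := fun t => t.1) hcard
    (fun t ht t' ht' h => by_contra fun hne => (hinj t ht t' ht' hne).1 h)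
    (fun j => g (2 * q + j))
  have h₂ := sum_comp_eq_sum_range (f := fun t => t.2.1) hcard
    (fun t ht t' ht' h => by_contra fun hne => (hinj t ht t' ht' hne).2.1 h)
    (fun j => g (q + j))
  have h₃ := sum_comp_eq_sum_range (f := fun t => t.2.2) hcard
    (fun t ht t' ht' h => by_contra fun hne => (hinj t ht t' ht' hne).2.2 h) g
  have hfilter : (μ₁ ∪ μ₂).filter (· ∈ M₁) = μ₁ := by
    ext t
    simp only [Finset.mem_filter, Finset.mem_union]
    exact ⟨fun h => h.1.resolve_right fun h' => Finset.disjoint_left.1 hdisj h.2 (hμ₂ h'),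
      fun h => ⟨Or.inl h, hμ₁ h⟩⟩
  have h₀ : ∑ t ∈ μ₁ ∪ μ₂, (if t ∈ M₁ then g (3 * q + ρ t) else 0) =
      ∑ p ∈ Finset.range M₁.card, g (3 * q + p) := by
    rw [← Finset.sum_filter, hfilter]
    have himage : M₁.image ρ = Finset.range M₁.card := by
      apply Finset.coe_injective
      rw [Finset.coe_image, hρ.image_eq, Finset.coe_range]
    rw [← himage, Finset.sum_image hρ.injOn]
    refine Finset.sum_subset hμ₁ fun t ht hnot => ?_
    have hzero : digit b (3 * q + ρ t) r = 0 := by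
      by_contra h
      exact hnot ((hdig t ht).1 h)
    simp [hg, hzero]
  have htop : r / b ^ (3 * q + M₁.card) = q := by
    refine Nat.div_eq_of_lt_le hr1 ?_
    rwa [pow_succ, mul_comm] at hr2
  have hr := sum_digit_add_div b r (3 * q + M₁.card)
  rw [htop, show 3 * q + M₁.card = q + q + q + M₁.card by ring, Finset.sum_range_add,
    Finset.sum_range_add, Finset.sum_range_add, ← show 3 * q = q + q + q by ring,
    ← two_mul] at hr
  refine ⟨fun t => b ^ (3 * q + M₁.card) + (if t ∈ M₁ then g (3 * q + ρ t) else 0) +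
    (g (2 * q + t.1) + g (q + t.2.1) + g t.2.2), fun t ht => ?_, ?_⟩
  · have hm : g (2 * q + t.1) + g (q + t.2.1) + g t.2.2 ∈ matchSet q t :=
      ⟨_, _, _, hdle _, hdle _, hdle _, rfl⟩
    by_cases hM : t ∈ M₁
    · have hμ : t ∈ μ₁ := hfilter ▸ Finset.mem_filter.2 ⟨ht, hM⟩
      simp only [Psi, if_pos hM]
      exact ⟨_, _, Nat.one_le_iff_ne_zero.2 ((hdig t hM).2 hμ), hdle _, hm, rfl⟩
    · simp only [Psi, if_neg hM, add_zero]
      exact ⟨_, hm, rfl⟩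
  · simp only [Finset.sum_add_distrib, Finset.sum_const, hcard, smul_eq_mul]
    rw [h₀, h₁, h₂, h₃]
    simp only [hg]
    linarith
end

section
/- Let q ≥ 1, b = q + 1, and let M₁, M₂, m, α, ρ, m(t), Ψ(t), Ψ(P) be as in the construction. Let κ ≥ 1 and let n₁, …, n_κ be natural numbers (repetitions allowed), each belonging to Ψ(P), let I ⊆ Fin m, and suppose n₁ + ⋯ + n_κ = q·b^α + Σ_{p ∈ I} q·b^(3q+p) + Σ_{j=0}^{3q−1} q·b^j. Then κ = q. -/
theorem sum_range_mul_succ_pow (q N : ℕ) :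
    ∑ j ∈ Finset.range N, q * (q + 1) ^ j + 1 = (q + 1) ^ N := by
  induction N with
  | zero => simp
  | succ N ih => rw [Finset.sum_range_succ, pow_succ]; linarith

/-- If a combination of powers of `q + 1` below `(q + 1) ^ N`, plus a carry `c`, is congruent
to `-1` modulo `(q + 1) ^ N`, then the coefficients and `c` add up to at least `q * N`. -/
theorem mul_le_sum_of_pow_dvd (q N : ℕ) (c : ℕ) (f : ℕ → ℕ)
    (h : (q + 1) ^ N ∣ c + 1 + ∑ j ∈ Finset.range N, f j * (q + 1) ^ j) :
    q * N ≤ c + ∑ j ∈ Finset.range N, f j := by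
  induction N generalizing c f with
  | zero => simp
  | succ N ih =>
    have hs : ∑ j ∈ Finset.range (N + 1), f j * (q + 1) ^ j
        = (q + 1) * ∑ j ∈ Finset.range N, f (j + 1) * (q + 1) ^ j + f 0 := by
      rw [Finset.sum_range_succ', Finset.mul_sum]
      congr 1
      · exact Finset.sum_congr rfl fun j _ => by ring
      · simp
    rw [hs] at h
    have hd : q + 1 ∣ c + f 0 + 1 := by
      have h1 := (dvd_pow_self (q + 1) N.succ_ne_zero).trans h
      have h2 : c + 1 + ((q + 1) * ∑ j ∈ Finset.range N, f (j + 1) * (q + 1) ^ j + f 0)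
        = (q + 1) * ∑ j ∈ Finset.range N, f (j + 1) * (q + 1) ^ j + (c + f 0 + 1) := by ring
      rw [h2] at h1
      exact (Nat.dvd_add_right (dvd_mul_right _ _)).1 h1
    obtain ⟨_ | k, hk⟩ := hd
    · simp at hk
    have h3 : (q + 1) ^ N ∣ k + 1 + ∑ j ∈ Finset.range N, f (j + 1) * (q + 1) ^ j := by
      apply Nat.dvd_of_mul_dvd_mul_left (Nat.succ_pos q)
      convert h using 1
      · rw [pow_succ, mul_comm]
      · rw [mul_add, Nat.succ_eq_add_one, ← hk]; ring
    have := ih k (fun j => f (j + 1)) h3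
    rw [Finset.sum_range_succ']
    nlinarith [Nat.zero_le (q * k)]

theorem exists_coeff_of_mem_matchSet {q : ℕ} {t : Fin q × Fin q × Fin q} {s : ℕ}
    (hs : s ∈ matchSet q t) :
    ∃ f : ℕ → ℕ, ∑ j ∈ Finset.range (3 * q), f j ≤ 3 * q ∧
      s = ∑ j ∈ Finset.range (3 * q), f j * (q + 1) ^ j := by
  obtain ⟨d₁, d₂, d₃, h₁, h₂, h₃, rfl⟩ := hs
  have l₁ : 2 * q + (t.1 : ℕ) < 3 * q := by omega
  have l₂ : q + (t.2.1 : ℕ) < 3 * q := by omega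
  have l₃ : (t.2.2 : ℕ) < 3 * q := by omega
  refine ⟨fun j => (if 2 * q + (t.1 : ℕ) = j then d₁ else 0)
    + (if q + (t.2.1 : ℕ) = j then d₂ else 0) + (if (t.2.2 : ℕ) = j then d₃ else 0), ?_, ?_⟩
  · simp only [Finset.sum_add_distrib, Finset.sum_ite_eq, Finset.mem_range, l₁, l₂, l₃, if_true]
    omega
  · simp only [add_mul, ite_mul, zero_mul, Finset.sum_add_distrib, Finset.sum_ite_eq,
      Finset.mem_range, l₁, l₂, l₃, if_true]

theorem exists_coeff_of_mem_PsiP {q : ℕ} {M₁ M₂ : Finset (Fin q × Fin q × Fin q)}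
    {ρ : Fin q × Fin q × Fin q → ℕ} {n : ℕ} (hn : n ∈ PsiP q M₁ M₂ ρ) :
    (q + 1) ^ (3 * q + M₁.card) ≤ n ∧ ∃ (c : ℕ) (f : ℕ → ℕ),
      ∑ j ∈ Finset.range (3 * q), f j ≤ 3 * q ∧
      n = (q + 1) ^ (3 * q) * c + ∑ j ∈ Finset.range (3 * q), f j * (q + 1) ^ j := by
  simp only [PsiP, Set.mem_iUnion] at hn
  obtain ⟨t, -, hn⟩ := hn
  unfold Psi at hn
  split_ifs at hn
  · obtain ⟨d₀, s, -, -, hs, rfl⟩ := hn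
    obtain ⟨f, hf, rfl⟩ := exists_coeff_of_mem_matchSet hs
    exact ⟨by rw [add_assoc]; exact Nat.le_add_right _ _,
      (q + 1) ^ M₁.card + d₀ * (q + 1) ^ ρ t, f, hf, by ring⟩
  · obtain ⟨s, hs, rfl⟩ := hn
    obtain ⟨f, hf, rfl⟩ := exists_coeff_of_mem_matchSet hs
    exact ⟨Nat.le_add_right _ _, (q + 1) ^ M₁.card, f, hf, by ring⟩

/-- statement (III) of the paper: if `n₁ + ⋯ + n_κ`, with each `nᵢ`
drawn from `Ψ(P)`, equals the target `q·b^α + Σ_{p ∈ I} q·b^(3q+p) + Σ_{j<3q} q·b^j`,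
then `κ = q`. -/
theorem stmt_8 (q : ℕ) (hq : 1 ≤ q)
    (M₁ M₂ : Finset (Fin q × Fin q × Fin q)) (hdisj : Disjoint M₁ M₂)
    (ρ : Fin q × Fin q × Fin q → ℕ)
    (hρ : Set.BijOn ρ ↑M₁ (Set.Iio M₁.card))
    (κ : ℕ) (hκ : 1 ≤ κ) (n : Fin κ → ℕ)
    (hn : ∀ i : Fin κ, n i ∈ PsiP q M₁ M₂ ρ)
    (I : Finset ℕ) (hI : ∀ p ∈ I, p < M₁.card)
    (hsum : ∑ i, n i =
      q * (q + 1) ^ (3 * q + M₁.card)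
        + ∑ p ∈ I, q * (q + 1) ^ (3 * q + p)
        + ∑ j ∈ Finset.range (3 * q), q * (q + 1) ^ j) :
    κ = q := by
  have hb : 0 < (q + 1) ^ (3 * q + M₁.card) := by positivity
  choose hle c F hF hnF using fun i => exists_coeff_of_mem_PsiP (hn i)
  have hlow := sum_range_mul_succ_pow q (3 * q)
  apply le_antisymm
  · have h1 : κ * (q + 1) ^ (3 * q + M₁.card) ≤ ∑ i, n i := by
      simpa using Finset.sum_le_sum fun i (_ : i ∈ Finset.univ) => hle i
    have h2 : ∑ p ∈ I, q * (q + 1) ^ (3 * q + p)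
        ≤ ∑ p ∈ Finset.range M₁.card, q * (q + 1) ^ (3 * q + p) :=
      Finset.sum_le_sum_of_subset fun p hp => Finset.mem_range.2 (hI p hp)
    have h3 := sum_range_mul_succ_pow q (3 * q + M₁.card)
    rw [Finset.sum_range_add] at h3
    have h4 : κ * (q + 1) ^ (3 * q + M₁.card) < (q + 1) * (q + 1) ^ (3 * q + M₁.card) := by
      linarith
    exact Nat.lt_succ_iff.1 (lt_of_mul_lt_mul_right h4 hb.le)
  · have hdvd : (q + 1) ^ (3 * q) ∣ ∑ i, n i + 1 := by
      rw [hsum, add_assoc, hlow]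
      refine dvd_add (dvd_add ?_ (Finset.dvd_sum fun p _ => ?_)) dvd_rfl <;>
        exact Dvd.dvd.mul_left (pow_dvd_pow _ (Nat.le_add_right _ _)) _
    have hsplit : ∑ i, n i + 1 = (q + 1) ^ (3 * q) * ∑ i, c i
        + (0 + 1 + ∑ j ∈ Finset.range (3 * q), (∑ i, F i j) * (q + 1) ^ j) := by
      simp_rw [Finset.sum_mul]
      rw [Finset.sum_comm, Finset.mul_sum, Finset.sum_congr rfl fun i _ => hnF i,
        Finset.sum_add_distrib]
      ring
    rw [hsplit] at hdvd
    have h1 := mul_le_sum_of_pow_dvd q (3 * q) 0 _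
      ((Nat.dvd_add_right (dvd_mul_right _ _)).1 hdvd)
    rw [Finset.sum_comm, zero_add] at h1
    have h2 : ∑ i, ∑ j ∈ Finset.range (3 * q), F i j ≤ κ * (3 * q) := by
      simpa using Finset.sum_le_sum fun i (_ : i ∈ Finset.univ) => hF i
    exact Nat.le_of_mul_le_mul_right (h1.trans h2) (by omega)
end

section
/- Let q ≥ 1, b = q + 1, and let M₁, M₂, m, α, ρ, m(t), Ψ(t), Ψ(P) be as in the construction. Let κ ≥ 1 and let n₁, …, n_κ be natural numbers (repetitions allowed), each belonging to Ψ(P), let I ⊆ Fin m, and suppose n₁ + ⋯ + n_κ = q·b^α + Σ_{p ∈ I} q·b^(3q+p) + Σ_{j=0}^{3q−1} q·b^j. Then for every position j with 0 ≤ j < 3q, and for every position j = 3q + p with p ∈ I, there is exactly one index k ∈ {1, …, κ} such that the base-b digit of n_k at position j is nonzero. -/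
/-- A sum of multiples of distinct powers of `b` below `b ^ N`, with coefficients less than `b`,
is less than `b ^ N`. -/
theorem sum_mul_pow_lt {b : ℕ} (hb : 0 < b) (f : ℕ → ℕ) (J : Finset ℕ) :
    ∀ N : ℕ, (∀ j ∈ J, j < N ∧ f j < b) → ∑ j ∈ J, f j * b ^ j < b ^ N := by
  induction J using Finset.induction_on_max with
  | empty =>
    intro N _
    simpa using Nat.pow_pos hb
  | insert a s hs ih =>
    intro N h
    rw [Finset.sum_insert fun ha => (hs a ha).false]
    have hrest := ih a fun j hj => ⟨hs j hj, (h j (Finset.mem_insert_of_mem hj)).2⟩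
    obtain ⟨haN, hfa⟩ := h a (Finset.mem_insert_self a s)
    calc f a * b ^ a + ∑ j ∈ s, f j * b ^ j < f a * b ^ a + b ^ a := by gcongr
      _ = (f a + 1) * b ^ a := by ring
      _ ≤ b * b ^ a := Nat.mul_le_mul_right _ hfa
      _ = b ^ (a + 1) := by ring
      _ ≤ b ^ N := Nat.pow_le_pow_right hb haN

theorem digit_mul_pow_add {b a j : ℕ} (hja : j < a) (c n : ℕ) :
    digit b j (c * b ^ a + n) = digit b j n := by
  obtain ⟨k, rfl⟩ := Nat.exists_eq_add_of_lt hja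
  simp only [digit, ← Nat.mod_mul_right_div_self, ← pow_succ]
  rw [show c * b ^ (j + k + 1) = b ^ (j + 1) * (c * b ^ k) by ring, Nat.mul_add_mod]

/-- The digits of a sum of multiples of distinct powers of `b` with coefficients less than `b`. -/
theorem digit_sum_mul_pow {b : ℕ} (hb : 0 < b) (f : ℕ → ℕ) (J : Finset ℕ) (j : ℕ)
    (hf : ∀ i ∈ J, f i < b) :
    digit b j (∑ i ∈ J, f i * b ^ i) = if j ∈ J then f j else 0 := by
  induction J using Finset.induction_on_max with
  | empty => simp [digit]
  | insert a s hs ih =>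
    have hfs : ∀ i ∈ s, f i < b := fun i hi => hf i (Finset.mem_insert_of_mem hi)
    have hfa := hf a (Finset.mem_insert_self a s)
    have has : a ∉ s := fun ha => (hs a ha).false
    rcases lt_trichotomy j a with hja | rfl | hja
    · rw [Finset.sum_insert has, digit_mul_pow_add hja, ih hfs]
      simp [hja.ne]
    · have hlt := sum_mul_pow_lt hb f s j fun i hi => ⟨hs i hi, hfs i hi⟩
      rw [Finset.sum_insert has, digit, mul_comm, Nat.mul_add_div (Nat.pow_pos hb),
        Nat.div_eq_of_lt hlt]
      simp [Nat.mod_eq_of_lt hfa]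
    · have hjs : j ∉ insert a s := by
        simp only [Finset.mem_insert, not_or]
        exact ⟨hja.ne', fun h => (hs j h).not_gt hja⟩
      have hlt := sum_mul_pow_lt hb f (insert a s) j fun i hi => by
        refine ⟨?_, hf i hi⟩
        rcases Finset.mem_insert.mp hi with rfl | hi
        · exact hja
        · exact (hs i hi).trans hja
      simp [hjs, digit, Nat.div_eq_of_lt hlt]

/-- When at most `q` numbers are added in base `q + 1`, carries are less than `q`, so a digit `q` of
the sum forces a nonzero digit in some summand. -/
theorem exists_digit_ne_zero_of_digit_sum_eq {q κ j : ℕ} (hq : 1 ≤ q) (hκ : κ ≤ q) (n : Fin κ → ℕ)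
    (h : digit (q + 1) j (∑ i, n i) = q) : ∃ i, digit (q + 1) j (n i) ≠ 0 := by
  by_contra! h0
  have hpos : 0 < (q + 1) ^ j := by positivity
  have hmod (i : Fin κ) : n i % (q + 1) ^ (j + 1) ≤ (q + 1) ^ j - 1 := by
    have hi := h0 i
    rw [digit, ← Nat.mod_mul_right_div_self, ← pow_succ,
      Nat.div_eq_zero_iff_lt hpos] at hi
    exact Nat.le_sub_one_of_lt hi
  have hS : ∑ i, n i % (q + 1) ^ (j + 1) < q * (q + 1) ^ j :=
    calc ∑ i, n i % (q + 1) ^ (j + 1) ≤ ∑ _i : Fin κ, ((q + 1) ^ j - 1) :=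
          Finset.sum_le_sum fun i _ => hmod i
      _ = κ * ((q + 1) ^ j - 1) := by simp
      _ ≤ q * ((q + 1) ^ j - 1) := Nat.mul_le_mul_right _ hκ
      _ < q * (q + 1) ^ j := Nat.mul_lt_mul_of_pos_left (by omega) hq
  have hle : (∑ i, n i) % (q + 1) ^ (j + 1) ≤ ∑ i, n i % (q + 1) ^ (j + 1) := by
    rw [Finset.sum_nat_mod]
    exact Nat.mod_le _ _
  have hlt := (Nat.div_lt_iff_lt_mul hpos).mpr (hle.trans_lt hS)
  rw [pow_succ, Nat.mod_mul_right_div_self] at hlt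
  exact hlt.ne h

/-- Below the leading position, the nonzero digits of an element of `PsiP` sit at the positions
given by the coordinates and, for triples of `M₁`, the rank of its triple. -/
theorem exists_triple_of_mem_PsiP {q : ℕ} {M₁ M₂ : Finset (Fin q × Fin q × Fin q)}
    {ρ : Fin q × Fin q × Fin q → ℕ} (hρ : ∀ t ∈ M₁, ρ t < M₁.card) {n : ℕ}
    (hn : n ∈ PsiP q M₁ M₂ ρ) :
    ∃ t : Fin q × Fin q × Fin q, (q + 1) ^ (3 * q + M₁.card) ≤ n ∧
      ∀ j < 3 * q + M₁.card, digit (q + 1) j n ≠ 0 →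
        (j = 2 * q + t.1 ∨ j = q + t.2.1 ∨ j = t.2.2) ∨ (t ∈ M₁ ∧ j = 3 * q + ρ t) := by
  simp only [PsiP, Set.mem_iUnion] at hn
  obtain ⟨t, -, ht⟩ := hn
  refine ⟨t, ?_⟩
  by_cases hM : t ∈ M₁
  · rw [Psi, if_pos hM] at ht
    obtain ⟨d₀, s, -, hd₀, ⟨d₁, d₂, d₃, hd₁, hd₂, hd₃, rfl⟩, rfl⟩ := ht
    have hρt := hρ t hM
    refine ⟨by omega, fun j hj hdig => ?_⟩
    let f : ℕ → ℕ := fun i => if i = 3 * q + ρ t then d₀ else if i = 2 * q + t.1 then d₁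
      else if i = q + t.2.1 then d₂ else d₃
    let J : Finset ℕ := {3 * q + ρ t, 2 * q + t.1.val, q + t.2.1.val, t.2.2.val}
    have hsum : (q + 1) ^ (3 * q + M₁.card) + d₀ * (q + 1) ^ (3 * q + ρ t) +
        (d₁ * (q + 1) ^ (2 * q + (t.1 : ℕ)) + d₂ * (q + 1) ^ (q + (t.2.1 : ℕ))
          + d₃ * (q + 1) ^ ((t.2.2 : ℕ))) =
        1 * (q + 1) ^ (3 * q + M₁.card) + ∑ i ∈ J, f i * (q + 1) ^ i := by
      rw [Finset.sum_insert (by simp; omega), Finset.sum_insert (by simp; omega),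
        Finset.sum_insert (by simp; omega), Finset.sum_singleton]
      have e₁ : f (3 * q + ρ t) = d₀ := by grind
      have e₂ : f (2 * q + t.1) = d₁ := by grind
      have e₃ : f (q + t.2.1) = d₂ := by grind
      have e₄ : f t.2.2 = d₃ := by grind
      rw [e₁, e₂, e₃, e₄]
      ring
    rw [hsum, digit_mul_pow_add hj, digit_sum_mul_pow (by omega) f J j (by grind)] at hdig
    grind
  · rw [Psi, if_neg hM] at ht
    obtain ⟨s, ⟨d₁, d₂, d₃, hd₁, hd₂, hd₃, rfl⟩, rfl⟩ := ht
    refine ⟨by omega, fun j hj hdig => ?_⟩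
    let f : ℕ → ℕ := fun i => if i = 2 * q + t.1 then d₁ else if i = q + t.2.1 then d₂ else d₃
    let J : Finset ℕ := {2 * q + t.1.val, q + t.2.1.val, t.2.2.val}
    have hsum : (q + 1) ^ (3 * q + M₁.card) +
        (d₁ * (q + 1) ^ (2 * q + (t.1 : ℕ)) + d₂ * (q + 1) ^ (q + (t.2.1 : ℕ))
          + d₃ * (q + 1) ^ ((t.2.2 : ℕ))) =
        1 * (q + 1) ^ (3 * q + M₁.card) + ∑ i ∈ J, f i * (q + 1) ^ i := by
      rw [Finset.sum_insert (by simp; omega), Finset.sum_insert (by simp; omega),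
        Finset.sum_singleton]
      have e₂ : f (2 * q + t.1) = d₁ := by grind
      have e₃ : f (q + t.2.1) = d₂ := by grind
      have e₄ : f t.2.2 = d₃ := by grind
      rw [e₂, e₃, e₄]
      ring
    rw [hsum, digit_mul_pow_add hj, digit_sum_mul_pow (by omega) f J j (by grind)] at hdig
    grind

theorem injective_of_surjective_of_le {κ q : ℕ} (h : κ ≤ q) {c : Fin κ → Fin q}
    (hc : Function.Surjective c) : Function.Injective c :=
  (hc.bijective_of_nat_card_le (by simpa using h)).injective

/-- statement (IV) of the paper: in any decomposition of the target as
a sum of elements of `Ψ(P)`, every position `j < 3q` and every position `3q + p` with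
`p ∈ I` receives a nonzero base-b digit from exactly one summand. -/
theorem stmt_9 (q : ℕ) (hq : 1 ≤ q)
    (M₁ M₂ : Finset (Fin q × Fin q × Fin q)) (hdisj : Disjoint M₁ M₂)
    (ρ : Fin q × Fin q × Fin q → ℕ)
    (hρ : Set.BijOn ρ ↑M₁ (Set.Iio M₁.card))
    (κ : ℕ) (hκ : 1 ≤ κ) (n : Fin κ → ℕ)
    (hn : ∀ i : Fin κ, n i ∈ PsiP q M₁ M₂ ρ)
    (I : Finset ℕ) (hI : ∀ p ∈ I, p < M₁.card)
    (hsum : ∑ i, n i =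
      q * (q + 1) ^ (3 * q + M₁.card)
        + ∑ p ∈ I, q * (q + 1) ^ (3 * q + p)
        + ∑ j ∈ Finset.range (3 * q), q * (q + 1) ^ j) :
    ∀ j : ℕ, (j < 3 * q ∨ ∃ p ∈ I, j = 3 * q + p) →
      ∃! i : Fin κ, digit (q + 1) j (n i) ≠ 0 := by
  have hρlt : ∀ t ∈ M₁, ρ t < M₁.card := fun t ht => hρ.mapsTo ht
  choose t hlead hpos using fun i => exists_triple_of_mem_PsiP hρlt (hn i)
  let J : Finset ℕ := insert (3 * q + M₁.card) (I.image (3 * q + ·) ∪ Finset.range (3 * q))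
  have hJ : ∑ i, n i = ∑ j ∈ J, q * (q + 1) ^ j := by
    rw [hsum, Finset.sum_insert, Finset.sum_union, Finset.sum_image, add_assoc]
    · intro x _ y _ hxy
      exact Nat.add_left_cancel hxy
    · rw [Finset.disjoint_left]
      simp
    · simp only [Finset.mem_union, Finset.mem_image, Finset.mem_range, not_or]
      refine ⟨?_, by omega⟩
      rintro ⟨p, hp, hpe⟩
      have := hI p hp
      omega
  have hκq : κ ≤ q := by
    have hlt : ∑ j ∈ J, q * (q + 1) ^ j < (q + 1) ^ (3 * q + M₁.card + 1) := by
      refine sum_mul_pow_lt q.succ_pos (fun _ => q) J _ fun j hj => ⟨?_, q.lt_succ_self⟩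
      simp only [J, Finset.mem_insert, Finset.mem_union, Finset.mem_image, Finset.mem_range] at hj
      rcases hj with rfl | ⟨p, hp, rfl⟩ | hj
      · omega
      · have := hI p hp
        omega
      · omega
    have hge : κ * (q + 1) ^ (3 * q + M₁.card) ≤ ∑ i, n i := by
      simpa using Finset.card_nsmul_le_sum Finset.univ n _ fun i _ => hlead i
    rw [← hJ, pow_succ'] at hlt
    exact Nat.le_of_lt_succ (Nat.lt_of_mul_lt_mul_right (hge.trans_lt hlt))
  have hex : ∀ j ∈ J, ∃ i, digit (q + 1) j (n i) ≠ 0 := fun j hj => by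
    refine exists_digit_ne_zero_of_digit_sum_eq hq hκq n ?_
    rw [hJ, digit_sum_mul_pow q.succ_pos (fun _ => q) J j fun _ _ => q.lt_succ_self, if_pos hj]
  have hmem : ∀ j < 3 * q, j ∈ J := fun j hj => by simp [J, hj]
  have hinj₁ : Function.Injective fun i => (t i).1 := by
    refine injective_of_surjective_of_le hκq fun x => ?_
    obtain ⟨i, hi⟩ := hex (2 * q + x) (hmem _ (by omega))
    refine ⟨i, Fin.ext ?_⟩
    have := hpos i _ (by omega) hi
    grind
  have hinj₂ : Function.Injective fun i => (t i).2.1 := by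
    refine injective_of_surjective_of_le hκq fun x => ?_
    obtain ⟨i, hi⟩ := hex (q + x) (hmem _ (by omega))
    refine ⟨i, Fin.ext ?_⟩
    have := hpos i _ (by omega) hi
    grind
  have hinj₃ : Function.Injective fun i => (t i).2.2 := by
    refine injective_of_surjective_of_le hκq fun x => ?_
    obtain ⟨i, hi⟩ := hex x (hmem _ (by omega))
    refine ⟨i, Fin.ext ?_⟩
    have := hpos i _ (by omega) hi
    grind
  intro j hj
  have hjJ : j ∈ J := by
    rcases hj with hj | ⟨p, hp, rfl⟩
    · exact hmem j hj
    · simp [J, hp]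
  have hjα : j < 3 * q + M₁.card := by
    rcases hj with hj | ⟨p, hp, rfl⟩
    · omega
    · have := hI p hp
      omega
  obtain ⟨i, hi⟩ := hex j hjJ
  refine ⟨i, hi, fun k hk => ?_⟩
  rcases hpos k j hjα hk with (hk | hk | hk) | ⟨hkM, hk⟩ <;>
  rcases hpos i j hjα hi with (hi | hi | hi) | ⟨hiM, hi⟩ <;> try omega
  · exact hinj₁ (Fin.ext (by dsimp only; omega))
  · exact hinj₂ (Fin.ext (by dsimp only; omega))
  · exact hinj₃ (Fin.ext (by dsimp only; omega))
  · exact hinj₁ (congrArg Prod.fst (hρ.injOn hkM hiM (by omega)))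
end

section
/- Let q ≥ 1, b = q + 1, and let M₁, M₂, m, α, ρ, m(t), Ψ(t), Ψ(P) be as in the construction. Then the following are equivalent: (a) for every subset μ₁ ⊆ M₁ there exists a subset μ₂ ⊆ M₂ such that μ₁ ∪ μ₂ is a perfect matching; (b) every integer k with q·b^α ≤ k ≤ b^(α+1) − 1 is a nonnegative integer combination of the set Ψ(P). -/
open Finset

/-- The total coefficient collected at position `j` by the terms `d i` placed at `p i`. -/
def coeffAt {ι : Type*} (s : Finset ι) (p d : ι → ℕ) (j : ℕ) : ℕ :=
  ∑ i ∈ s with p i = j, d i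

lemma sum_coeffAt_mul {ι : Type*} (s : Finset ι) (p d w : ι → ℕ) (v : ℕ → ℕ) (n : ℕ)
    (hp : ∀ i ∈ s, p i < n) (hw : ∀ i ∈ s, w i = v (p i)) :
    ∑ j ∈ range n, coeffAt s p d j * v j = ∑ i ∈ s, d i * w i := by
  rw [← sum_fiberwise_of_maps_to (t := range n) (g := p) (fun i hi => mem_range.2 (hp i hi))]
  refine sum_congr rfl fun j _ => ?_
  rw [coeffAt, sum_mul]
  refine sum_congr rfl fun i hi => ?_
  obtain ⟨his, rfl⟩ := mem_filter.1 hi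
  rw [hw i his]

lemma coeffAt_of_injOn {ι : Type*} {s : Finset ι} {p d : ι → ℕ} (hp : Set.InjOn p s)
    {i : ι} (hi : i ∈ s) : coeffAt s p d (p i) = d i := by
  have : {x ∈ s | p x = p i} = {i} := by
    ext x
    simp only [mem_filter, mem_singleton]
    exact ⟨fun h => hp h.1 hi h.2, by rintro rfl; exact ⟨hi, rfl⟩⟩
  rw [coeffAt, this, sum_singleton]

lemma exists_of_coeffAt_ne_zero {ι : Type*} {s : Finset ι} {p d : ι → ℕ} {j : ℕ}
    (h : coeffAt s p d j ≠ 0) : ∃ i ∈ s, p i = j := by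
  obtain ⟨i, hi, -⟩ := exists_ne_zero_of_sum_ne_zero h
  exact ⟨i, (mem_filter.1 hi).1, (mem_filter.1 hi).2⟩

lemma coeffAt_le_of_injOn {ι : Type*} {s : Finset ι} {p d : ι → ℕ} (hp : Set.InjOn p s)
    {q : ℕ} (hd : ∀ i ∈ s, d i ≤ q) (j : ℕ) : coeffAt s p d j ≤ q := by
  by_cases h : coeffAt s p d j = 0
  · omega
  · obtain ⟨i, hi, rfl⟩ := exists_of_coeffAt_ne_zero h
    rw [coeffAt_of_injOn hp hi]
    exact hd i hi

lemma injOn_of_coeffAt_le {ι : Type*} {s : Finset ι} {p d : ι → ℕ} {q : ℕ} (hq : 1 ≤ q)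
    (hd : ∀ i ∈ s, d i = q) (h : ∀ i ∈ s, coeffAt s p d (p i) ≤ q) : Set.InjOn p s := by
  intro i hi i' hi' hii
  by_contra hne
  have := add_le_sum (s := {x ∈ s | p x = p i}) (f := d) (fun _ _ => Nat.zero_le _)
    (mem_filter.2 ⟨hi, rfl⟩) (mem_filter.2 ⟨hi', hii.symm⟩) hne
  have h1 := h i hi
  rw [coeffAt] at h1
  rw [hd i hi, hd i' hi'] at this
  omega

lemma sum_range_succ_mul_pow (b : ℕ) (c : ℕ → ℕ) (n : ℕ) :
    ∑ j ∈ range (n + 1), c j * b ^ j = b * ∑ j ∈ range n, c (j + 1) * b ^ j + c 0 := by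
  rw [sum_range_succ', mul_sum]
  simp only [pow_zero, mul_one]
  congr 1
  exact sum_congr rfl fun j _ => by ring

lemma sum_mul_pow_lt_s11 {q : ℕ} {c : ℕ → ℕ} (hc : ∀ j, c j ≤ q) (n : ℕ) :
    ∑ j ∈ range n, c j * (q + 1) ^ j < (q + 1) ^ n := by
  induction n with
  | zero => simp
  | succ n ih =>
    rw [sum_range_succ, pow_succ]
    have := Nat.mul_le_mul_right ((q + 1) ^ n) (hc n)
    linarith

lemma coeff_eq_of_sum_mul_pow_eq {q : ℕ} (n : ℕ) : ∀ {c c' : ℕ → ℕ}, (∀ j, c j ≤ q) →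
    (∀ j, c' j ≤ q) →
    ∑ j ∈ range n, c j * (q + 1) ^ j = ∑ j ∈ range n, c' j * (q + 1) ^ j →
    ∀ j < n, c j = c' j := by
  induction n with
  | zero => intro _ _ _ _ _ j hj; omega
  | succ n ih =>
    intro c c' hc hc' h
    rw [sum_range_succ_mul_pow, sum_range_succ_mul_pow] at h
    have h0 : c 0 = c' 0 := by
      have := congrArg (· % (q + 1)) h
      simpa [Nat.mul_add_mod, Nat.mod_eq_of_lt (Nat.lt_succ_of_le (hc 0)),
        Nat.mod_eq_of_lt (Nat.lt_succ_of_le (hc' 0))] using this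
    rw [h0] at h
    have h1 := ih (fun j => hc (j + 1)) (fun j => hc' (j + 1))
      (Nat.eq_of_mul_eq_mul_left (Nat.succ_pos q) (Nat.add_right_cancel h))
    intro j hj
    cases j with
    | zero => exact h0
    | succ j => exact h1 j (by omega)

lemma sum_digit_mul_pow (b k n : ℕ) : ∑ j ∈ range n, digit b j k * b ^ j = k % b ^ n := by
  induction n with
  | zero => simp [Nat.mod_one]
  | succ n ih => rw [sum_range_succ, ih, pow_succ, Nat.mod_mul, digit]; ring

/-- A weighted sum of powers of `q + 1` congruent to `-1` modulo `(q + 1) ^ n` has total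
coefficient at least `n * q`, and in case of equality there are no carries. -/
lemma le_sum_of_dvd_sum_mul_pow_add_one {q : ℕ} (hq : 1 ≤ q) (n : ℕ) : ∀ {c : ℕ → ℕ},
    (q + 1) ^ n ∣ ∑ j ∈ range n, c j * (q + 1) ^ j + 1 →
    n * q ≤ ∑ j ∈ range n, c j ∧ (∑ j ∈ range n, c j ≤ n * q → ∀ j < n, c j = q) := by
  induction n with
  | zero => intro c _; simp
  | succ n ih =>
    intro c h
    rw [sum_range_succ_mul_pow, pow_succ'] at h
    have h0 : (q + 1) ∣ c 0 + 1 := by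
      have := (Dvd.intro _ rfl : (q + 1) ∣ _).trans h
      rw [add_assoc] at this
      exact (Nat.dvd_add_right (Dvd.intro _ rfl)).1 this
    obtain ⟨e, he⟩ := h0
    obtain ⟨e, rfl⟩ : ∃ e', e = e' + 1 := ⟨e - 1, by
      rcases e with _ | e
      · omega
      · rfl⟩
    rw [add_assoc, he, ← mul_add] at h
    have h1 := Nat.dvd_of_mul_dvd_mul_left (Nat.succ_pos q) h
    cases n with
    | zero =>
      have : c 0 = q + (q + 1) * e := by linarith
      refine ⟨by simp; nlinarith, fun hle j hj => ?_⟩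
      obtain rfl : j = 0 := by omega
      simp at hle
      nlinarith
    | succ n =>
      let c' : ℕ → ℕ := fun j => c (j + 1) + if j = 0 then e else 0
      have hs : ∑ j ∈ range (n + 1), c' j * (q + 1) ^ j
          = ∑ j ∈ range (n + 1), c (j + 1) * (q + 1) ^ j + e := by
        simp [c', add_mul, sum_add_distrib, ite_mul]
      have hs' : ∑ j ∈ range (n + 1), c' j = ∑ j ∈ range (n + 1), c (j + 1) + e := by
        simp [c', sum_add_distrib]
      obtain ⟨h2, h3⟩ := ih (c := c') (by rw [hs, add_assoc]; exact h1)
      rw [hs'] at h2 h3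
      rw [sum_range_succ']
      have hc0 : c 0 = q + q * e + e := by linarith
      have hqe : e ≤ q * e := Nat.le_mul_of_pos_left e hq
      have hmul : (n + 1 + 1) * q = (n + 1) * q + q := by ring
      refine ⟨by omega, fun hle j hj => ?_⟩
      have he0 : e = 0 := by omega
      subst he0
      cases j with
      | zero => simpa using hc0
      | succ j => simpa [c'] using h3 (by omega) j (by omega)

lemma mem_PsiP_iff {q : ℕ} {M₁ M₂ : Finset (Fin q × Fin q × Fin q)}
    {ρ : Fin q × Fin q × Fin q → ℕ} {n : ℕ} :
    n ∈ PsiP q M₁ M₂ ρ ↔ ∃ (t : Fin q × Fin q × Fin q) (d₀ d₁ d₂ d₃ : ℕ), t ∈ M₁ ∪ M₂ ∧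
      (t ∈ M₁ → 1 ≤ d₀) ∧ (t ∉ M₁ → d₀ = 0) ∧ d₀ ≤ q ∧ d₁ ≤ q ∧ d₂ ≤ q ∧ d₃ ≤ q ∧
      n = (q + 1) ^ (3 * q + M₁.card) + d₀ * (q + 1) ^ (3 * q + ρ t) +
        (d₁ * (q + 1) ^ (2 * q + (t.1 : ℕ)) + d₂ * (q + 1) ^ (q + (t.2.1 : ℕ))
          + d₃ * (q + 1) ^ ((t.2.2 : ℕ))) := by
  simp only [PsiP, Set.mem_iUnion]
  constructor
  · rintro ⟨t, ht, h⟩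
    by_cases htM : t ∈ M₁
    · rw [Psi, if_pos htM] at h
      obtain ⟨d₀, s, h1, h2, ⟨d₁, d₂, d₃, h3, h4, h5, rfl⟩, rfl⟩ := h
      exact ⟨t, d₀, d₁, d₂, d₃, ht, fun _ => h1, fun h => absurd htM h, h2, h3, h4, h5, rfl⟩
    · rw [Psi, if_neg htM] at h
      obtain ⟨s, ⟨d₁, d₂, d₃, h3, h4, h5, rfl⟩, rfl⟩ := h
      exact ⟨t, 0, d₁, d₂, d₃, ht, fun h => absurd h htM, fun _ => rfl, Nat.zero_le _,
        h3, h4, h5, by simp⟩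
  · rintro ⟨t, d₀, d₁, d₂, d₃, ht, h1, h0, h2, h3, h4, h5, rfl⟩
    refine ⟨t, ht, ?_⟩
    by_cases htM : t ∈ M₁
    · rw [Psi, if_pos htM]
      exact ⟨d₀, _, h1 htM, h2, ⟨d₁, d₂, d₃, h3, h4, h5, rfl⟩, rfl⟩
    · rw [Psi, if_neg htM]
      exact ⟨_, ⟨d₁, d₂, d₃, h3, h4, h5, rfl⟩, by simp [h0 htM]⟩

lemma sum_eq_sum_range_of_injOn {ι : Type*} {q : ℕ} {ν : Finset ι} (hν : ν.card = q)
    {π : ι → Fin q} (hπ : Set.InjOn π ν) (F : ℕ → ℕ) :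
    ∑ t ∈ ν, F (π t) = ∑ j ∈ range q, F j := by
  classical
  have : ν.image π = univ := by
    rw [← card_eq_iff_eq_univ, card_image_of_injOn hπ, hν, Fintype.card_fin]
  rw [sum_range, ← this, sum_image hπ]

lemma mem_closure_of_extension {q : ℕ} {M₁ M₂ : Finset (Fin q × Fin q × Fin q)}
    (hdisj : Disjoint M₁ M₂) {ρ : Fin q × Fin q × Fin q → ℕ}
    (hρ : Set.BijOn ρ ↑M₁ (Set.Iio M₁.card))
    (h : ∀ μ₁ ⊆ M₁, ∃ μ₂ ⊆ M₂, IsPerfectMatching q (μ₁ ∪ μ₂)) {k : ℕ}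
    (hk : q * (q + 1) ^ (3 * q + M₁.card) ≤ k) (hk' : k < (q + 1) ^ (3 * q + M₁.card + 1)) :
    k ∈ AddSubmonoid.closure (PsiP q M₁ M₂ ρ) := by
  set b := q + 1 with hb
  have hD : ∀ j, digit b j k ≤ q := fun j => Nat.le_of_lt_succ (Nat.mod_lt _ (Nat.succ_pos q))
  obtain ⟨μ₂, hμ₂, hcard, hν⟩ := h {t ∈ M₁ | digit b (3 * q + ρ t) k ≠ 0} (filter_subset _ _)
  set μ₁ := {t ∈ M₁ | digit b (3 * q + ρ t) k ≠ 0} with hμ₁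
  let d₀ : Fin q × Fin q × Fin q → ℕ := fun t => if t ∈ M₁ then digit b (3 * q + ρ t) k else 0
  let x : Fin q × Fin q × Fin q → ℕ := fun t =>
    b ^ (3 * q + M₁.card) + d₀ t * b ^ (3 * q + ρ t) +
      (digit b (2 * q + (t.1 : ℕ)) k * b ^ (2 * q + (t.1 : ℕ))
        + digit b (q + (t.2.1 : ℕ)) k * b ^ (q + (t.2.1 : ℕ))
        + digit b (t.2.2 : ℕ) k * b ^ ((t.2.2 : ℕ)))
  have hdiv : k / b ^ (3 * q + M₁.card) = q := by
    apply Nat.div_eq_of_lt_le hk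
    rw [pow_succ, mul_comm] at hk'
    exact hk'
  have hM : ∀ t ∈ μ₁ ∪ μ₂, t ∈ M₁ → t ∈ μ₁ := by
    intro t ht htM
    rcases mem_union.1 ht with h | h
    · exact h
    · exact absurd (hμ₂ h) (disjoint_left.1 hdisj htM)
  have hx : ∑ t ∈ μ₁ ∪ μ₂, x t = k := by
    simp only [x, sum_add_distrib, sum_const, hcard, smul_eq_mul]
    rw [sum_eq_sum_range_of_injOn hcard (π := fun t => t.1)
        (fun t ht t' ht' e => by_contra fun hne => (hν t ht t' ht' hne).1 e)
        (fun j => digit b (2 * q + j) k * b ^ (2 * q + j)),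
      sum_eq_sum_range_of_injOn hcard (π := fun t => t.2.1)
        (fun t ht t' ht' e => by_contra fun hne => (hν t ht t' ht' hne).2.1 e)
        (fun j => digit b (q + j) k * b ^ (q + j)),
      sum_eq_sum_range_of_injOn hcard (π := fun t => t.2.2)
        (fun t ht t' ht' e => by_contra fun hne => (hν t ht t' ht' hne).2.2 e)
        (fun j => digit b j k * b ^ j)]
    have hup : ∑ t ∈ μ₁ ∪ μ₂, d₀ t * b ^ (3 * q + ρ t)
        = ∑ j ∈ range M₁.card, digit b (3 * q + j) k * b ^ (3 * q + j) := by
      trans ∑ t ∈ M₁, digit b (3 * q + ρ t) k * b ^ (3 * q + ρ t)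
      · rw [← sum_subset (filter_subset _ M₁ : μ₁ ⊆ M₁) (fun t ht ht' => by
          have : digit b (3 * q + ρ t) k = 0 := by
            by_contra h0
            exact ht' (mem_filter.2 ⟨ht, h0⟩)
          simp [this])]
        rw [← sum_subset (subset_union_left : μ₁ ⊆ μ₁ ∪ μ₂) (fun t ht ht' => by
          have : t ∉ M₁ := fun h => ht' (hM t ht h)
          simp [d₀, this])]
        refine sum_congr rfl fun t ht => ?_
        simp [d₀, (mem_filter.1 ht).1]
      · refine sum_nbij ρ (fun t ht => mem_range.2 (hρ.mapsTo ht)) hρ.injOn ?_ fun _ _ => rfl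
        rw [coe_range]
        exact hρ.surjOn
    rw [hup]
    conv_rhs => rw [← Nat.div_add_mod k (b ^ (3 * q + M₁.card)), hdiv, ← sum_digit_mul_pow]
    have h3 : 3 * q = q + q + q := by ring
    have h2 : 2 * q = q + q := by ring
    rw [h3, h2, sum_range_add, sum_range_add, sum_range_add]
    ring
  rw [← hx]
  refine sum_mem fun t ht => AddSubmonoid.subset_closure (mem_PsiP_iff.2
    ⟨t, d₀ t, _, _, _, ?_, fun htM => ?_, fun htM => ?_, ?_, hD _, hD _, hD _, rfl⟩)
  · exact union_subset_union (filter_subset _ _) hμ₂ ht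
  · have := (mem_filter.1 (hM t ht htM)).2
    simp only [d₀, if_pos htM]
    omega
  · simp [d₀, htM]
  · simp only [d₀]
    split_ifs
    · exact hD _
    · exact Nat.zero_le _

lemma exists_extension_of_mem_closure {q : ℕ} (hq : 1 ≤ q)
    {M₁ M₂ : Finset (Fin q × Fin q × Fin q)} {ρ : Fin q × Fin q × Fin q → ℕ}
    (hρ : Set.BijOn ρ ↑M₁ (Set.Iio M₁.card))
    (h : ∀ k : ℕ, q * (q + 1) ^ (3 * q + M₁.card) ≤ k →
        k < (q + 1) ^ (3 * q + M₁.card + 1) → k ∈ AddSubmonoid.closure (PsiP q M₁ M₂ ρ))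
    {μ₁ : Finset (Fin q × Fin q × Fin q)} (hμ₁ : μ₁ ⊆ M₁) :
    ∃ μ₂ ⊆ M₂, IsPerfectMatching q (μ₁ ∪ μ₂) := by
  have hρμ : Set.InjOn ρ μ₁ := hρ.injOn.mono hμ₁
  set u : ℕ → ℕ := coeffAt μ₁ ρ (fun _ => 1) with hu
  have huq : ∀ j, u j ≤ q := coeffAt_le_of_injOn hρμ (fun _ _ => hq)
  set U := ∑ j ∈ range M₁.card, u j * (q + 1) ^ j with hU
  have hUlt : U < (q + 1) ^ M₁.card := sum_mul_pow_lt_s11 huq _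
  have hpos : 1 ≤ (q + 1) ^ (3 * q) := Nat.one_le_pow _ _ (Nat.succ_pos q)
  have hpow : (q + 1) ^ (3 * q + M₁.card) = (q + 1) ^ (3 * q) * (q + 1) ^ M₁.card := pow_add _ _ _
  set k := q * (q + 1) ^ (3 * q + M₁.card) + (q + 1) ^ (3 * q) * U + ((q + 1) ^ (3 * q) - 1)
    with hk
  have hk1 : k + 1 = q * (q + 1) ^ (3 * q + M₁.card) + (q + 1) ^ (3 * q) * (U + 1) := by
    rw [mul_add]
    omega
  have hklt : k < (q + 1) ^ (3 * q + M₁.card + 1) := by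
    have : (q + 1) ^ (3 * q) * (U + 1) ≤ (q + 1) ^ (3 * q + M₁.card) := by
      rw [hpow]
      exact Nat.mul_le_mul_left _ hUlt
    rw [pow_succ]
    linarith
  obtain ⟨l, hl, hsum⟩ := AddSubmonoid.exists_list_of_mem_closure
    (h k (by rw [hk, add_assoc]; exact Nat.le_add_right _ _) hklt)
  obtain ⟨N, x, hget, hsum'⟩ : ∃ (N : ℕ) (x : Fin N → ℕ),
      (∀ i, x i ∈ PsiP q M₁ M₂ ρ) ∧ ∑ i, x i = k :=
    ⟨l.length, l.get, fun i => hl _ (List.get_mem l i), by rw [← hsum]; simp⟩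
  simp only [mem_PsiP_iff] at hget
  choose t d₀ d₁ d₂ d₃ ht hd₀pos hd₀zero hd₀ hd₁ hd₂ hd₃ hx using hget
  simp only [hx, sum_add_distrib, sum_const, card_univ, Fintype.card_fin, smul_eq_mul] at hsum'
  have hNq : N ≤ q := by
    by_contra hN
    have : (q + 1) * (q + 1) ^ (3 * q + M₁.card) ≤ N * (q + 1) ^ (3 * q + M₁.card) :=
      Nat.mul_le_mul_right _ (by omega)
    rw [pow_succ, mul_comm] at hklt
    omega
  -- the low-order part
  let c₁ := coeffAt univ (fun i => 2 * q + ((t i).1 : ℕ)) d₁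
  let c₂ := coeffAt univ (fun i => q + ((t i).2.1 : ℕ)) d₂
  let c₃ := coeffAt univ (fun i => ((t i).2.2 : ℕ)) d₃
  have hp₁ : ∀ i ∈ univ, 2 * q + ((t i).1 : ℕ) < 3 * q := fun i _ => by
    have := (t i).1.2
    omega
  have hp₂ : ∀ i ∈ univ, q + ((t i).2.1 : ℕ) < 3 * q := fun i _ => by
    have := (t i).2.1.2
    omega
  have hp₃ : ∀ i ∈ univ, ((t i).2.2 : ℕ) < 3 * q := fun i _ => by
    have := (t i).2.2.2
    omega
  have hlow := congrArg₂ (· + ·) (congrArg₂ (· + ·)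
    (sum_coeffAt_mul univ _ d₁ _ ((q + 1) ^ ·) (3 * q) hp₁ fun _ _ => rfl)
    (sum_coeffAt_mul univ _ d₂ _ ((q + 1) ^ ·) (3 * q) hp₂ fun _ _ => rfl))
    (sum_coeffAt_mul univ _ d₃ _ ((q + 1) ^ ·) (3 * q) hp₃ fun _ _ => rfl)
  have htot := congrArg₂ (· + ·) (congrArg₂ (· + ·)
    (sum_coeffAt_mul univ _ d₁ _ (fun _ => 1) (3 * q) hp₁ fun _ _ => rfl)
    (sum_coeffAt_mul univ _ d₂ _ (fun _ => 1) (3 * q) hp₂ fun _ _ => rfl))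
    (sum_coeffAt_mul univ _ d₃ _ (fun _ => 1) (3 * q) hp₃ fun _ _ => rfl)
  simp only [mul_one] at htot
  simp only [← sum_add_distrib, ← add_mul] at hlow htot
  simp only [sum_add_distrib (s := (univ : Finset (Fin N)))] at hlow
  change ∑ j ∈ range (3 * q), (c₁ j + c₂ j + c₃ j) * (q + 1) ^ j = _ at hlow
  change ∑ j ∈ range (3 * q), (c₁ j + c₂ j + c₃ j) = _ at htot
  rw [← hlow] at hsum'
  have hhigh : ∑ i, d₀ i * (q + 1) ^ (3 * q + ρ (t i))
      = (q + 1) ^ (3 * q) * ∑ i, d₀ i * (q + 1) ^ ρ (t i) := by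
    rw [mul_sum]
    exact sum_congr rfl fun i _ => by ring
  rw [hhigh] at hsum'
  obtain ⟨hge, heq⟩ := le_sum_of_dvd_sum_mul_pow_add_one hq (3 * q)
    (c := fun j => c₁ j + c₂ j + c₃ j) (by
      have hdvd : (q + 1) ^ (3 * q) ∣ k + 1 := by
        rw [hk1, hpow]
        exact dvd_add (Dvd.dvd.mul_left (Dvd.intro _ rfl) _) (Dvd.intro _ rfl)
      rw [← hsum', add_assoc] at hdvd
      refine (Nat.dvd_add_right (dvd_add ?_ (Dvd.intro _ rfl))).1 hdvd
      rw [hpow]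
      exact Dvd.dvd.mul_left (Dvd.intro _ rfl) _)
  rw [htot] at hge heq
  have hdle : ∀ i ∈ univ, d₁ i + d₂ i + d₃ i ≤ 3 * q := fun i _ => by
    have := hd₁ i; have := hd₂ i; have := hd₃ i
    omega
  have hle : ∑ i, (d₁ i + d₂ i + d₃ i) ≤ N * (3 * q) := by
    simpa using sum_le_sum hdle
  have hN : N = q := by
    have : 3 * q * q ≤ 3 * q * N := by linarith
    exact le_antisymm hNq (Nat.le_of_mul_le_mul_left this (by omega))
  have hNmul : ∀ y, N * y = q * y := fun y => by rw [hN]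
  have hc : ∀ j < 3 * q, c₁ j + c₂ j + c₃ j = q := heq (by rw [hNmul] at hle; linarith)
  have hdeq : ∀ i, d₁ i + d₂ i + d₃ i = 3 * q := by
    have : ∑ i, (d₁ i + d₂ i + d₃ i) = ∑ _i : Fin N, 3 * q := by
      refine le_antisymm (sum_le_sum hdle) ?_
      simp only [sum_const, card_univ, Fintype.card_fin, smul_eq_mul, hN]
      linarith
    exact fun i => (sum_eq_sum_iff_of_le hdle).1 this i (mem_univ i)
  have hd : ∀ i, d₁ i = q ∧ d₂ i = q ∧ d₃ i = q := fun i => by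
    have := hd₁ i; have := hd₂ i; have := hd₃ i; have := hdeq i
    omega
  have hinj₁ := injOn_of_coeffAt_le hq (fun i _ => (hd i).1) fun i hi =>
    show c₁ _ ≤ q by have := hc _ (hp₁ i hi); omega
  have hinj₂ := injOn_of_coeffAt_le hq (fun i _ => (hd i).2.1) fun i hi =>
    show c₂ _ ≤ q by have := hc _ (hp₂ i hi); omega
  have hinj₃ := injOn_of_coeffAt_le hq (fun i _ => (hd i).2.2) fun i hi =>
    show c₃ _ ≤ q by have := hc _ (hp₃ i hi); omega
  have htinj : Function.Injective t := fun i i' e =>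
    hinj₁ (mem_coe.2 (mem_univ i)) (mem_coe.2 (mem_univ i')) (by simp only [e])
  have hmatch : IsPerfectMatching q (univ.image t) := by
    refine ⟨by rw [card_image_of_injective _ htinj, card_univ, Fintype.card_fin, hN], ?_⟩
    intro x hx y hy hxy
    obtain ⟨i, -, rfl⟩ := mem_image.1 hx
    obtain ⟨i', -, rfl⟩ := mem_image.1 hy
    have hne : i ≠ i' := fun e => hxy (by rw [e])
    refine ⟨fun e => hne ?_, fun e => hne ?_, fun e => hne ?_⟩
    · exact hinj₁ (mem_coe.2 (mem_univ i)) (mem_coe.2 (mem_univ i')) (by simp only [e])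
    · exact hinj₂ (mem_coe.2 (mem_univ i)) (mem_coe.2 (mem_univ i')) (by simp only [e])
    · exact hinj₃ (mem_coe.2 (mem_univ i)) (mem_coe.2 (mem_univ i')) (by simp only [e])
  -- the high-order part
  let s : Finset (Fin N) := {i | t i ∈ M₁}
  have hs : ∀ i, i ∈ s ↔ t i ∈ M₁ := fun i => by simp [s]
  have hsinj : Set.InjOn (fun i => ρ (t i)) s := fun i hi i' hi' e =>
    htinj (hρ.injOn ((hs i).1 hi) ((hs i').1 hi') e)
  have hvalue : ∑ j ∈ range (3 * q), (c₁ j + c₂ j + c₃ j) * (q + 1) ^ j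
      = (q + 1) ^ (3 * q) - 1 := by
    have h1 : ∑ j ∈ range (3 * q), (c₁ j + c₂ j + c₃ j) * (q + 1) ^ j
        = q * ∑ j ∈ range (3 * q), (q + 1) ^ j := by
      rw [mul_sum]
      exact sum_congr rfl fun j hj => by rw [hc j (mem_range.1 hj)]
    have h2 := Nat.geomSum_eq (m := q + 1) (by omega) (3 * q)
    rw [h1, h2, Nat.add_sub_cancel]
    apply Nat.mul_div_cancel'
    simpa using Nat.sub_dvd_pow_sub_pow (q + 1) 1 (3 * q)
  have hhighU : ∑ i, d₀ i * (q + 1) ^ ρ (t i) = U := by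
    rw [hvalue, hk, hNmul] at hsum'
    refine Nat.eq_of_mul_eq_mul_left hpos ?_
    omega
  have hcoeff : ∀ j < M₁.card, coeffAt s (fun i => ρ (t i)) d₀ j = u j := by
    refine coeff_eq_of_sum_mul_pow_eq _ (coeffAt_le_of_injOn hsinj fun i _ => hd₀ i) huq ?_
    rw [← hU, ← hhighU, sum_coeffAt_mul s (fun i => ρ (t i)) d₀ (fun i => (q + 1) ^ ρ (t i))
      ((q + 1) ^ ·) _ (fun i hi => hρ.mapsTo ((hs i).1 hi)) fun _ _ => rfl]
    refine sum_subset (subset_univ _) fun i _ hi => ?_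
    rw [hd₀zero i fun hm => hi ((hs i).2 hm), zero_mul]
  have hmem : ∀ x ∈ M₁, x ∈ univ.image t ↔ x ∈ μ₁ := by
    intro x hxM
    have hxρ := hcoeff (ρ x) (hρ.mapsTo hxM)
    constructor
    · intro hx
      obtain ⟨i, -, rfl⟩ := mem_image.1 hx
      have h1 : coeffAt s (fun i => ρ (t i)) d₀ (ρ (t i)) = d₀ i :=
        coeffAt_of_injOn hsinj ((hs i).2 hxM)
      have h2 := hd₀pos i hxM
      obtain ⟨y, hy, hyx⟩ := exists_of_coeffAt_ne_zero (s := μ₁) (p := ρ) (d := fun _ => 1)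
        (j := ρ (t i)) (by rw [← hu]; omega)
      rwa [← hρ.injOn (hμ₁ hy) hxM hyx]
    · intro hx
      have h1 : u (ρ x) = 1 := coeffAt_of_injOn hρμ hx
      obtain ⟨i, hi, hix⟩ := exists_of_coeffAt_ne_zero (s := s) (p := fun i => ρ (t i))
        (d := d₀) (j := ρ x) (by omega)
      rw [← hρ.injOn ((hs i).1 hi) hxM hix]
      exact mem_image_of_mem t (mem_univ i)
  refine ⟨univ.image t \ M₁, fun x hx => ?_, ?_⟩
  · obtain ⟨hx, hxM⟩ := mem_sdiff.1 hx
    obtain ⟨i, -, rfl⟩ := mem_image.1 hx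
    exact (mem_union.1 (ht i)).resolve_left hxM
  · convert hmatch using 1
    ext x
    rw [mem_union, mem_sdiff]
    constructor
    · rintro (hx | hx)
      · exact (hmem x (hμ₁ hx)).2 hx
      · exact hx.1
    · intro hx
      by_cases hxM : x ∈ M₁
      · exact Or.inl ((hmem x hxM).1 hx)
      · exact Or.inr ⟨hx, hxM⟩

/-- validity of the reduction of Theorem 1: every subset of `M₁`
extends by a subset of `M₂` to a perfect matching iff every integer in the interval
`[q·b^α, b^(α+1) − 1]` is a nonnegative integer combination of `Ψ(P)`. -/
theorem stmt_11 (q : ℕ) (hq : 1 ≤ q)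
    (M₁ M₂ : Finset (Fin q × Fin q × Fin q)) (hdisj : Disjoint M₁ M₂)
    (ρ : Fin q × Fin q × Fin q → ℕ)
    (hρ : Set.BijOn ρ ↑M₁ (Set.Iio M₁.card)) :
    (∀ μ₁ ⊆ M₁, ∃ μ₂ ⊆ M₂, IsPerfectMatching q (μ₁ ∪ μ₂)) ↔
      (∀ k : ℕ, q * (q + 1) ^ (3 * q + M₁.card) ≤ k →
        k ≤ (q + 1) ^ (3 * q + M₁.card + 1) - 1 →
        k ∈ AddSubmonoid.closure (PsiP q M₁ M₂ ρ)) := by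
  have hpos : 0 < (q + 1) ^ (3 * q + M₁.card + 1) := Nat.pow_pos (Nat.succ_pos q)
  constructor
  · intro h k hk hk'
    exact mem_closure_of_extension hdisj hρ h hk (by omega)
  · intro h μ₁ hμ₁
    exact exists_extension_of_mem_closure hq hρ (fun k hk hk' => h k hk (by omega)) hμ₁
end

section
/- Let A be a nonempty finite set of positive integers, let a = min A, and let λ be a positive integer. Then every integer k with λ ≤ k ≤ λ + a − 1 is a nonnegative integer combination of A if and only if either 1 ∈ A, or all of the following hold: A has at least two elements, every element of A is at least 2, the greatest common divisor of the elements of A is 1, and the Frobenius number g of A satisfies g < λ. -/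
theorem Nat.setGcd_coe_finset (s : Finset ℕ) : Nat.setGcd (s : Set ℕ) = s.gcd id :=
  Nat.dvd_antisymm
    (Finset.dvd_gcd fun _ hx => Nat.setGcd_dvd_of_mem (Finset.mem_coe.mpr hx))
    (Nat.dvd_setGcd_iff.mpr fun _ hx => Finset.gcd_dvd (f := id) (Finset.mem_coe.mp hx))

/-- If an additive submonoid of `ℕ` contains `a > 0` and a full window of `a` consecutive
numbers, then it contains everything from the start of the window on. -/
theorem AddSubmonoid.mem_of_window {S : AddSubmonoid ℕ} {a m : ℕ} (ha : a ∈ S) (hpos : 0 < a)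
    (h : ∀ k, m ≤ k → k < m + a → k ∈ S) (n : ℕ) (hn : m ≤ n) : n ∈ S := by
  induction n using Nat.strong_induction_on with
  | _ n ih =>
    rcases lt_or_ge n (m + a) with hlt | hge
    · exact h n hn hlt
    · have := S.add_mem (ih (n - a) (by omega) (by omega)) ha
      rwa [Nat.sub_add_cancel (by omega)] at this

/-- validity of the reduction of Theorem 5: for a nonempty finite set
`A` of positive integers and a positive integer `λ`, every integer in
`[λ, λ + min A − 1]` is a nonnegative integer combination of `A` iff either `1 ∈ A`,
or `A` has at least two elements, each at least 2, their gcd is 1, and the Frobenius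
number `g` of `A` satisfies `g < λ`. -/
theorem stmt_12 (A : Finset ℕ) (hA : A.Nonempty) (hpos : ∀ x ∈ A, 0 < x)
    (lam : ℕ) (hlam : 0 < lam) :
    (∀ k : ℕ, lam ≤ k → k ≤ lam + A.min' hA - 1 →
      k ∈ AddSubmonoid.closure (A : Set ℕ)) ↔
    (1 ∈ A ∨
      (2 ≤ A.card ∧ (∀ x ∈ A, 2 ≤ x) ∧ A.gcd id = 1 ∧
        ∀ g : ℕ, IsGreatest {n : ℕ | n ∉ AddSubmonoid.closure (A : Set ℕ)} g →
          g < lam)) := by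
  constructor
  · intro h
    by_cases h1 : 1 ∈ A
    · exact Or.inl h1
    have hmem := AddSubmonoid.mem_of_window
      (AddSubmonoid.subset_closure (Finset.mem_coe.mpr (A.min'_mem hA)))
      (hpos _ (A.min'_mem hA)) (fun k hk hk' => h k hk (by omega))
    have htwo : ∀ x ∈ A, 2 ≤ x := by
      intro x hx
      have := hpos x hx
      have : x ≠ 1 := fun e => h1 (e ▸ hx)
      omega
    have hgcd : A.gcd id = 1 := by
      rw [← Nat.setGcd_coe_finset]
      exact Nat.dvd_one.mp <| (Nat.dvd_add_right
        (Nat.setGcd_dvd_of_mem_closure (hmem lam le_rfl))).mp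
        (Nat.setGcd_dvd_of_mem_closure (hmem (lam + 1) (by omega)))
    refine Or.inr ⟨?_, htwo, hgcd, fun g hg => lt_of_not_ge fun hle => hg.1 (hmem g hle)⟩
    by_contra hcard
    obtain ⟨x, rfl⟩ := Finset.card_eq_one.mp
      (show A.card = 1 by have := hA.card_pos; omega)
    exact h1 (by simpa [eq_comm] using hgcd)
  · rintro (h1 | ⟨-, htwo, hgcd, hg⟩) k hk -
    · have := (AddSubmonoid.closure (A : Set ℕ)).nsmul_mem
        (AddSubmonoid.subset_closure (Finset.mem_coe.mpr h1)) k
      simpa using this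
    · obtain ⟨g, hfrob⟩ := exists_frobeniusNumber_iff.mpr
        ⟨(Nat.setGcd_coe_finset A).trans hgcd,
          fun h1 => absurd (htwo 1 (Finset.mem_coe.mp h1)) (by omega)⟩
      exact (frobeniusNumber_iff.mp hfrob).2 k ((hg g hfrob).trans_le hk)
end
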